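/- arXiv:1010.6148 — 5 statements merged into one kernel-verified Lean document; each statement's English description precedes it below -/
import Mathlib

section
/- Suppose Assumptions 1 and 2 hold. Let x = (x_1,…,x_N) ∈ ℝⁿ with x ≠ 0 and let e = (e_1,…,e_N) be such that V_i(x_i) ≥ χ_i(‖e_i‖) for every i ∈ {1,…,N}. Then for every index i at which the maximum defining V(x) is attained (i.e. V(x) = σ_i⁻¹(V_i(x_i))), one has ∇V_i(x_i)·f_i(x, g_i(x + e)) ≤ −α_i(‖x_i‖). -/
/-- A function `f : [0,∞) → [0,∞)` is of class K if it is continuous, strictly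
increasing and `f 0 = 0`. -/
def ClassK (f : ℝ → ℝ) : Prop :=
  ContinuousOn f (Set.Ici 0) ∧ StrictMonoOn f (Set.Ici 0) ∧
    (∀ r, 0 ≤ r → 0 ≤ f r) ∧ f 0 = 0

/-- A function is of class K∞ if it is of class K and unbounded. -/
def ClassKInf (f : ℝ → ℝ) : Prop :=
  ClassK f ∧ Filter.Tendsto f Filter.atTop Filter.atTop

/-- A continuous positive definite function `[0,∞) → [0,∞)`: vanishing exactly at 0. -/
def PosDefFun (f : ℝ → ℝ) : Prop :=
  ContinuousOn f (Set.Ici 0) ∧ (∀ r, 0 ≤ r → 0 ≤ f r) ∧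
    (∀ r, 0 ≤ r → (f r = 0 ↔ r = 0))

/-- A monotone aggregation function on `[0,∞)^m`: continuous, nonnegative, positive on
nonzero nonnegative vectors, strictly increasing componentwise, and unbounded. -/
def MAF {m : ℕ} (μ : (Fin m → ℝ) → ℝ) : Prop :=
  Continuous μ ∧
    (∀ v : Fin m → ℝ, (∀ k, 0 ≤ v k) → 0 ≤ μ v) ∧
    (∀ v : Fin m → ℝ, (∀ k, 0 ≤ v k) → v ≠ 0 → 0 < μ v) ∧
    (∀ v z : Fin m → ℝ, (∀ k, z k < v k) → μ z < μ v) ∧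
    (∀ M : ℝ, ∃ R : ℝ, ∀ v : Fin m → ℝ, (∀ k, 0 ≤ v k) → R ≤ ‖v‖ → M ≤ μ v)

theorem ClassK.monotoneOn {f : ℝ → ℝ} (hf : ClassK f) : MonotoneOn f (Set.Ici 0) :=
  hf.2.1.monotoneOn

theorem ClassKInf.exists_eq {f : ℝ → ℝ} (hf : ClassKInf f) {r : ℝ} (hr : 0 ≤ r) :
    ∃ s, 0 ≤ s ∧ f s = r := by
  obtain ⟨b, hb, hrb⟩ :=
    ((Filter.eventually_ge_atTop 0).and (hf.2.eventually_ge_atTop r)).exists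
  obtain ⟨s, hs, rfl⟩ := intermediate_value_Icc hb
    (hf.1.1.mono Set.Icc_subset_Ici_self) ⟨by rwa [hf.1.2.2.2], hrb⟩
  exact ⟨s, hs.1, rfl⟩

/-- A left inverse on `[0,∞)` of a class K∞ function maps `[0,∞)` to itself. -/
theorem ClassKInf.leftInv_nonneg {f finv : ℝ → ℝ} (hf : ClassKInf f)
    (hinv : ∀ r, 0 ≤ r → finv (f r) = r) {r : ℝ} (hr : 0 ≤ r) : 0 ≤ finv r := by
  obtain ⟨s, hs, rfl⟩ := hf.exists_eq hr
  rwa [hinv s hs]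

/-- A monotone aggregation function is monotone for the non-strict componentwise order. -/
theorem MAF.monotone {m : ℕ} {μ : (Fin m → ℝ) → ℝ} (hμ : MAF μ) : Monotone μ := by
  intro z v hzv
  have hc : Continuous fun ε : ℝ => μ (fun k => v k + ε) :=
    hμ.1.comp (by fun_prop)
  have ht : Filter.Tendsto (fun ε : ℝ => μ (fun k => v k + ε)) (nhdsWithin 0 (Set.Ioi 0))
      (nhds (μ v)) := by
    simpa using (hc.tendsto 0).mono_left nhdsWithin_le_nhds
  refine ge_of_tendsto ht ?_
  filter_upwards [self_mem_nhdsWithin] with ε hε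
  exact (hμ.2.2.2.1 _ _ fun k => lt_add_of_le_of_pos (hzv k) hε).le

/-- **Theorem 1 of the paper.** Under Assumptions 1 (decentralized ISS-Lyapunov
functions `V_i` with gains `γ_{ij}`, `η_{ij}` aggregated by MAFs `μ_i`) and 2
(Ω-path `σ` and perturbation gains `φ_{ij}` satisfying the perturbed small-gain
condition), if `x ≠ 0` and `V_i(x_i) ≥ χ_i(‖e_i‖)` for all `i`, where
`χ_j = σ_j ∘ η̂_j` and `η̂_j = max_{i : η_{ij} ≢ 0} φ_{ij}⁻¹ ∘ η_{ij}`, then for every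
index `i` attaining the maximum in `V(x) = max_k σ_k⁻¹(V_k(x_k))` one has
`∇V_i(x_i)·f_i(x, g_i(x + e)) ≤ −α_i(‖x_i‖)`. -/
theorem statement0
    (N : ℕ) (hN : 0 < N)
    (n m : Fin N → ℕ)
    (f : ∀ i : Fin N, (∀ j, EuclideanSpace ℝ (Fin (n j))) →
      EuclideanSpace ℝ (Fin (m i)) → EuclideanSpace ℝ (Fin (n i)))
    (g : ∀ i : Fin N, (∀ j, EuclideanSpace ℝ (Fin (n j))) → EuclideanSpace ℝ (Fin (m i)))
    (V : ∀ i : Fin N, EuclideanSpace ℝ (Fin (n i)) → ℝ)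
    (α₁ α₂ : Fin N → ℝ → ℝ)
    (μ : Fin N → (Fin (N + N) → ℝ) → ℝ)
    (γ η φ φinv : Fin N → Fin N → ℝ → ℝ)
    (αpd : Fin N → ℝ → ℝ)
    (σ σinv : Fin N → ℝ → ℝ)
    (ηhat χ : Fin N → ℝ → ℝ)
    -- Assumption 1
    (hVdiff : ∀ i, Differentiable ℝ (V i))
    (hα₁ : ∀ i, ClassKInf (α₁ i)) (hα₂ : ∀ i, ClassKInf (α₂ i))
    (hVbd : ∀ i xi, α₁ i ‖xi‖ ≤ V i xi ∧ V i xi ≤ α₂ i ‖xi‖)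
    (hμ : ∀ i, MAF (μ i))
    (hγ : ∀ i j, ClassKInf (γ i j) ∨ γ i j = 0)
    (hγdiag : ∀ i, γ i i = 0)
    (hη : ∀ i j, ClassKInf (η i j) ∨ η i j = 0)
    (hαpd : ∀ i, PosDefFun (αpd i))
    (hA1 : ∀ i (x e : ∀ j, EuclideanSpace ℝ (Fin (n j))),
      μ i (Fin.append (fun j => γ i j (V j (x j))) (fun j => η i j ‖e j‖)) ≤ V i (x i) →
      fderiv ℝ (V i) (x i) (f i x (g i (x + e))) ≤ -(αpd i ‖x i‖))
    -- Assumption 2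
    (hσ : ∀ i, ClassKInf (σ i))
    (hσinv : ∀ i r, 0 ≤ r → σinv i (σ i r) = r ∧ σ i (σinv i r) = r)
    (hφ : ∀ i j, (η i j ≠ 0 → ClassKInf (φ i j)) ∧ (η i j = 0 → φ i j = 0))
    (hφinv : ∀ i j, η i j ≠ 0 → ∀ r, 0 ≤ r → φinv i j (φ i j r) = r ∧ φ i j (φinv i j r) = r)
    (hA2 : ∀ i, ∀ r > (0 : ℝ),
      μ i (Fin.append (fun j => γ i j (σ j r)) (fun j => φ i j r)) < σ i r)
    -- definitions of `η̂_j` and `χ_j = σ_j ∘ η̂_j`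
    (hηhat : ∀ j r, ηhat j r = ⨆ i ∈ {i : Fin N | η i j ≠ 0}, φinv i j (η i j r))
    (hχ : ∀ j r, χ j r = σ j (ηhat j r))
    -- hypotheses on the state and the error
    (x e : ∀ j, EuclideanSpace ℝ (Fin (n j)))
    (hx : x ≠ 0)
    (he : ∀ i, χ i ‖e i‖ ≤ V i (x i)) :
    ∀ i, (⨆ k, σinv k (V k (x k))) = σinv i (V i (x i)) →
      fderiv ℝ (V i) (x i) (f i x (g i (x + e))) ≤ -(αpd i ‖x i‖) := by
  intro i hi
  have hV0 : ∀ j, 0 ≤ V j (x j) := fun j =>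
    ((hα₁ j).1.2.2.1 _ (norm_nonneg _)).trans (hVbd j (x j)).1
  have hs0 : ∀ j, 0 ≤ σinv j (V j (x j)) := fun j =>
    (hσ j).leftInv_nonneg (fun r hr => (hσinv j r hr).1) (hV0 j)
  have hσV : ∀ j, σ j (σinv j (V j (x j))) = V j (x j) := fun j => (hσinv j _ (hV0 j)).2
  obtain ⟨r, hr⟩ : ∃ r, r = σinv i (V i (x i)) := ⟨_, rfl⟩
  have hle : ∀ j, σinv j (V j (x j)) ≤ r := fun j => by
    rw [hr, ← hi]
    exact le_ciSup (f := fun k => σinv k (V k (x k))) (Set.finite_range _).bddAbove j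
  have hr0 : 0 < r := by
    obtain ⟨j, hj⟩ := Function.ne_iff.mp hx
    refine lt_of_lt_of_le (lt_of_le_of_ne (hs0 j) fun h => ?_) (hle j)
    have hVj : V j (x j) = 0 := by rw [← hσV j, ← h, (hσ j).1.2.2.2]
    have hpos : α₁ j 0 < α₁ j ‖x j‖ :=
      (hα₁ j).1.2.1 Set.self_mem_Ici (norm_nonneg _) (norm_pos_iff.mpr hj)
    rw [(hα₁ j).1.2.2.2] at hpos
    linarith [(hVbd j (x j)).1]
  have hVσ : ∀ j, V j (x j) ≤ σ j r := fun j => by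
    rw [← hσV j]
    exact (hσ j).1.monotoneOn (hs0 j) hr0.le (hle j)
  have hγle : ∀ j, γ i j (V j (x j)) ≤ γ i j (σ j r) := fun j => by
    rcases hγ i j with h | h
    · exact h.1.monotoneOn (hV0 j) ((hV0 j).trans (hVσ j)) (hVσ j)
    · simp [h]
  have hηφ : ∀ j, η i j ‖e j‖ ≤ φ i j r := fun j => by
    by_cases h : η i j = 0
    · simp [h, (hφ i j).2 h]
    have hη0 : ∀ k, η k j ≠ 0 → 0 ≤ η k j ‖e j‖ := fun k hk =>
      ((hη k j).resolve_right hk).1.2.2.1 _ (norm_nonneg _)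
    have hφ0 : ∀ k, η k j ≠ 0 → 0 ≤ φinv k j (η k j ‖e j‖) := fun k hk =>
      ((hφ k j).1 hk).leftInv_nonneg (fun s hs => (hφinv k j hk s hs).1) (hη0 k hk)
    have hhat : φinv i j (η i j ‖e j‖) ≤ ηhat j ‖e j‖ := by
      rw [hηhat]
      refine le_trans ?_ (le_ciSup (Set.finite_range _).bddAbove i)
      rw [ciSup_pos (show i ∈ {i : Fin N | η i j ≠ 0} from h)]
    have hhat0 : 0 ≤ ηhat j ‖e j‖ := (hφ0 i h).trans hhat
    have hhatle : ηhat j ‖e j‖ ≤ σinv j (V j (x j)) := by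
      refine ((hσ j).1.2.1.le_iff_le hhat0 (hs0 j)).mp ?_
      rw [hσV, ← hχ]
      exact he j
    rw [← (hφinv i j h _ (hη0 i h)).2]
    exact ((hφ i j).1 h).1.monotoneOn (hφ0 i h) hr0.le (hhat.trans (hhatle.trans (hle j)))
  apply hA1
  calc _ ≤ μ i (Fin.append (fun j => γ i j (σ j r)) (fun j => φ i j r)) :=
        (hμ i).monotone fun k => by
          refine Fin.addCases (fun j => ?_) (fun j => ?_) k
          · simpa only [Fin.append_left] using hγle j
          · simpa only [Fin.append_right] using hηφ j
    _ ≤ σ i r := (hA2 i r hr0).le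
    _ = V i (x i) := by rw [hr, hσV]
end

section
/- Suppose Assumptions 2 and 4 hold, and set ĉ = max_{1≤i≤N} max{c_i, σ_i⁻¹(c_i)}. Let x ∈ ℝⁿ and e be such that max{σ_j⁻¹(V_j(x_j)), c_j} ≥ η̂_j(‖e_j‖) for every j ∈ {1,…,N}, and suppose V(x) ≥ ĉ. Then for every index i at which the maximum defining V(x) is attained (i.e. V(x) = σ_i⁻¹(V_i(x_i))), one has ∇V_i(x_i)·f_i(x, g_i(x + e)) ≤ −α_i(‖x_i‖). -/
/-- An inverse of a class K∞ function is nonnegative on `[0,∞)`. -/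
theorem ClassKInf.inv_nonneg {f finv : ℝ → ℝ} (hf : ClassKInf f)
    (hinv : ∀ r, 0 ≤ r → finv (f r) = r ∧ f (finv r) = r) {r : ℝ} (hr : 0 ≤ r) :
    0 ≤ finv r := by
  obtain ⟨s, hs, rfl⟩ := hf.exists_eq hr
  rwa [(hinv s hs).1]

theorem ClassKInf.le_of_inv_le {f finv : ℝ → ℝ} (hf : ClassKInf f)
    (hinv : ∀ r, 0 ≤ r → finv (f r) = r ∧ f (finv r) = r) {r t : ℝ} (hr : 0 ≤ r)
    (h : finv r ≤ t) : r ≤ f t := by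
  have h0 := hf.inv_nonneg hinv hr
  simpa only [(hinv r hr).2] using hf.1.monotoneOn h0 (h0.trans h) h

theorem Fin.append_le_append {N M : ℕ} {a a' : Fin N → ℝ} {b b' : Fin M → ℝ}
    (ha : a ≤ a') (hb : b ≤ b') : Fin.append a b ≤ Fin.append a' b' := by
  intro k
  refine Fin.addCases (fun j => ?_) (fun j => ?_) k
  · simpa using ha j
  · simpa using hb j

theorem le_biSup_of_finite {ι : Type*} [Finite ι] (s : Set ι) (u : ι → ℝ) {i : ι}
    (hi : i ∈ s) : u i ≤ ⨆ k ∈ s, u k := by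
  calc u i = ⨆ _ : i ∈ s, u i := (ciSup_pos (f := fun _ => u i) hi).symm
    _ ≤ ⨆ k ∈ s, u k := le_ciSup (f := fun k => ⨆ _ : k ∈ s, u k) (Set.finite_range _).bddAbove i

/-- **Theorem 5 (practical version of Theorem 1) of the paper.** Under Assumptions 2
and 4 (input-to-state practical stability with constants `c_i > 0`), with
`ĉ = max_i max{c_i, σ_i⁻¹(c_i)}`: if `max{σ_j⁻¹(V_j(x_j)), c_j} ≥ η̂_j(‖e_j‖)` for
every `j` and `V(x) ≥ ĉ`, then for every index `i` attaining the maximum defining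
`V(x) = max_k σ_k⁻¹(V_k(x_k))` one has `∇V_i(x_i)·f_i(x, g_i(x + e)) ≤ −α_i(‖x_i‖)`. -/
theorem statement3
    (N : ℕ) (hN : 0 < N)
    (n m : Fin N → ℕ)
    (f : ∀ i : Fin N, (∀ j, EuclideanSpace ℝ (Fin (n j))) →
      EuclideanSpace ℝ (Fin (m i)) → EuclideanSpace ℝ (Fin (n i)))
    (g : ∀ i : Fin N, (∀ j, EuclideanSpace ℝ (Fin (n j))) → EuclideanSpace ℝ (Fin (m i)))
    (V : ∀ i : Fin N, EuclideanSpace ℝ (Fin (n i)) → ℝ)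
    (α₁ α₂ : Fin N → ℝ → ℝ)
    (μ : Fin N → (Fin (N + N) → ℝ) → ℝ)
    (γ η φ φinv : Fin N → Fin N → ℝ → ℝ)
    (αpd : Fin N → ℝ → ℝ)
    (c : Fin N → ℝ)
    (σ σinv : Fin N → ℝ → ℝ)
    (ηhat : Fin N → ℝ → ℝ)
    -- Assumption 4 (input-to-state practical stability)
    (hVdiff : ∀ i, Differentiable ℝ (V i))
    (hα₁ : ∀ i, ClassKInf (α₁ i)) (hα₂ : ∀ i, ClassKInf (α₂ i))
    (hVbd : ∀ i xi, α₁ i ‖xi‖ ≤ V i xi ∧ V i xi ≤ α₂ i ‖xi‖)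
    (hμ : ∀ i, MAF (μ i))
    (hγ : ∀ i j, ClassKInf (γ i j) ∨ γ i j = 0)
    (hγdiag : ∀ i, γ i i = 0)
    (hη : ∀ i j, ClassKInf (η i j) ∨ η i j = 0)
    (hαpd : ∀ i, PosDefFun (αpd i))
    (hc : ∀ i, 0 < c i)
    (hA4 : ∀ i (x e : ∀ j, EuclideanSpace ℝ (Fin (n j))),
      max (μ i (Fin.append (fun j => γ i j (V j (x j))) (fun j => η i j ‖e j‖))) (c i) ≤
          V i (x i) →
      fderiv ℝ (V i) (x i) (f i x (g i (x + e))) ≤ -(αpd i ‖x i‖))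
    -- Assumption 2
    (hσ : ∀ i, ClassKInf (σ i))
    (hσinv : ∀ i r, 0 ≤ r → σinv i (σ i r) = r ∧ σ i (σinv i r) = r)
    (hφ : ∀ i j, (η i j ≠ 0 → ClassKInf (φ i j)) ∧ (η i j = 0 → φ i j = 0))
    (hφinv : ∀ i j, η i j ≠ 0 → ∀ r, 0 ≤ r → φinv i j (φ i j r) = r ∧ φ i j (φinv i j r) = r)
    (hA2 : ∀ i, ∀ r > (0 : ℝ),
      μ i (Fin.append (fun j => γ i j (σ j r)) (fun j => φ i j r)) < σ i r)
    -- definition of `η̂_j`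
    (hηhat : ∀ j r, ηhat j r = ⨆ i ∈ {i : Fin N | η i j ≠ 0}, φinv i j (η i j r))
    -- hypotheses on the state and the error
    (x e : ∀ j, EuclideanSpace ℝ (Fin (n j)))
    (he : ∀ j, ηhat j ‖e j‖ ≤ max (σinv j (V j (x j))) (c j))
    (hVbig : (⨆ i, max (c i) (σinv i (c i))) ≤ ⨆ k, σinv k (V k (x k))) :
    ∀ i, (⨆ k, σinv k (V k (x k))) = σinv i (V i (x i)) →
      fderiv ℝ (V i) (x i) (f i x (g i (x + e))) ≤ -(αpd i ‖x i‖) := by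
  intro i hi
  set r := ⨆ k, σinv k (V k (x k)) with hr
  have hVr : ∀ j, σinv j (V j (x j)) ≤ r := fun j =>
    le_ciSup (f := fun k => σinv k (V k (x k))) (Set.finite_range _).bddAbove j
  have hcr : ∀ j, max (c j) (σinv j (c j)) ≤ r := fun j =>
    (le_ciSup (f := fun k => max (c k) (σinv k (c k)))
      (Set.finite_range _).bddAbove j).trans hVbig
  have hrpos : 0 < r := (hc i).trans_le ((le_max_left _ _).trans (hcr i))
  have hVnonneg : ∀ j, 0 ≤ V j (x j) := fun j =>
    ((hα₁ j).1.2.2.1 _ (norm_nonneg _)).trans (hVbd j (x j)).1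
  have hVσ : ∀ j, V j (x j) ≤ σ j r := fun j =>
    (hσ j).le_of_inv_le (hσinv j) (hVnonneg j) (hVr j)
  have hVi : σ i r = V i (x i) := by rw [hi, (hσinv i _ (hVnonneg i)).2]
  have hγle : ∀ j, γ i j (V j (x j)) ≤ γ i j (σ j r) := fun j => by
    rcases hγ i j with h | h
    · exact h.1.monotoneOn (hVnonneg j) ((hVnonneg j).trans (hVσ j)) (hVσ j)
    · simp [h]
  have hηle : ∀ j, η i j ‖e j‖ ≤ φ i j r := fun j => by
    by_cases h : η i j = 0
    · simp [h, (hφ i j).2 h]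
    · have hη0 : 0 ≤ η i j ‖e j‖ := ((hη i j).resolve_right h).1.2.2.1 _ (norm_nonneg _)
      refine ((hφ i j).1 h).le_of_inv_le (hφinv i j h) hη0 ?_
      calc φinv i j (η i j ‖e j‖) ≤ ηhat j ‖e j‖ := by
            rw [hηhat]
            exact le_biSup_of_finite {k | η k j ≠ 0} (fun k => φinv k j (η k j ‖e j‖)) h
        _ ≤ max (σinv j (V j (x j))) (c j) := he j
        _ ≤ r := max_le (hVr j) ((le_max_left _ _).trans (hcr j))
  refine hA4 i x e (max_le ?_ ?_)
  · rw [← hVi]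
    exact ((hμ i).monotone (Fin.append_le_append hγle hηle)).trans (hA2 i r hrpos).le
  · rw [← hVi]
    exact (hσ i).le_of_inv_le (hσinv i) (hc i).le ((le_max_right _ _).trans (hcr i))
end

section
/- Let t* > 0, let x : [0, t*] → ℝ^m be continuous, and let (s_k)_{k≥0} be a strictly increasing sequence in [0, t*) with s_k → t*. Let V : ℝ^m → [0,∞) be continuous and satisfy α₁(‖y‖) ≤ V(y) for all y ∈ ℝ^m, where α₁ is of class K∞, and let χ be of class K. If V(x(s_k)) = χ(‖x(s_{k−1}) − x(s_k)‖) for every k ≥ 1, then x(t*) = 0, and consequently x(s_k) → 0 as k → ∞. -/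
/-- Sequence-level content of the Zeno lemma: if the triggering condition
`V(x(s_k)) = χ(‖x(s_{k−1}) − x(s_k)‖)` fires at times `s_k` accumulating at a finite
time `t*`, where `x` is continuous on `[0, t*]`, `V` is continuous with class-K∞
lower bound `α₁(‖y‖) ≤ V(y)` and `χ` is of class K, then `x(t*) = 0` and
consequently `x(s_k) → 0`. -/
theorem statement7 (m : ℕ) (tstar : ℝ) (htstar : 0 < tstar)
    (x : ℝ → EuclideanSpace ℝ (Fin m))
    (hx : ContinuousOn x (Set.Icc 0 tstar))
    (s : ℕ → ℝ) (hs : StrictMono s)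
    (hsmem : ∀ k, s k ∈ Set.Ico (0 : ℝ) tstar)
    (hslim : Filter.Tendsto s Filter.atTop (nhds tstar))
    (V : EuclideanSpace ℝ (Fin m) → ℝ) (hV : Continuous V)
    (α₁ : ℝ → ℝ) (hα₁ : ClassKInf α₁)
    (hVlb : ∀ y, α₁ ‖y‖ ≤ V y)
    (χ : ℝ → ℝ) (hχ : ClassK χ)
    (htrig : ∀ k : ℕ, 1 ≤ k → V (x (s k)) = χ ‖x (s (k - 1)) - x (s k)‖) :
    x tstar = 0 ∧ Filter.Tendsto (fun k => x (s k)) Filter.atTop (nhds 0) := by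
  have hxlim : Filter.Tendsto (fun k => x (s k)) Filter.atTop (nhds (x tstar)) :=
    (hx tstar ⟨htstar.le, le_rfl⟩).tendsto.comp <|
      tendsto_nhdsWithin_iff.2 ⟨hslim, .of_forall fun k => Set.Ico_subset_Icc_self (hsmem k)⟩
  have hχlim : Filter.Tendsto (fun k => χ ‖x (s k) - x (s (k + 1))‖) Filter.atTop (nhds 0) := by
    have hnorm := (hxlim.sub (hxlim.comp (Filter.tendsto_add_atTop_nat 1))).norm
    rw [sub_self, norm_zero] at hnorm
    have hχ0 := (hχ.1 0 Set.self_mem_Ici).tendsto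
    rw [hχ.2.2.2] at hχ0
    exact hχ0.comp (tendsto_nhdsWithin_iff.2 ⟨hnorm, .of_forall fun k => norm_nonneg _⟩)
  have hVlim : Filter.Tendsto (fun k => V (x (s (k + 1)))) Filter.atTop (nhds (V (x tstar))) :=
    (hV.tendsto _).comp (hxlim.comp (Filter.tendsto_add_atTop_nat 1))
  have hV0 : V (x tstar) = 0 := by
    refine tendsto_nhds_unique hVlim (hχlim.congr fun k => ?_)
    simpa using (htrig (k + 1) (Nat.le_add_left 1 k)).symm
  have hx0 : x tstar = 0 := by
    by_contra hne
    have hpos := hα₁.1.2.1 Set.self_mem_Ici (norm_nonneg (x tstar)) (norm_pos_iff.2 hne)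
    rw [hα₁.1.2.2.2] at hpos
    exact (hpos.trans_le (hVlb _)).ne' hV0
  exact ⟨hx0, hx0 ▸ hxlim⟩
end

section
/- Let (t_k)_{k∈ℕ} be a strictly increasing sequence of real numbers converging to some finite t* ∈ ℝ, and let (a_k)_{k∈ℕ} be a sequence in ℝ^d with a_k ≠ 0 for every k and a_k → 0 as k → ∞. Then for every M > 0 and every K ∈ ℕ there exists k ≥ K such that ‖a_{k+1} − a_k‖ > M·(t_{k+1} − t_k)·‖a_{k+1}‖. -/
/-- If `‖v - u‖ ≤ c * ‖v‖`, then `‖u‖ ≤ exp c * ‖v‖`. -/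
theorem norm_le_exp_mul_norm_of_norm_sub_le {E : Type*} [SeminormedAddCommGroup E]
    {u v : E} {c : ℝ} (h : ‖v - u‖ ≤ c * ‖v‖) : ‖u‖ ≤ Real.exp c * ‖v‖ :=
  calc ‖u‖ ≤ ‖v‖ + ‖v - u‖ := norm_le_norm_add_norm_sub v u
    _ ≤ (c + 1) * ‖v‖ := by linarith
    _ ≤ Real.exp c * ‖v‖ := by gcongr; exact Real.add_one_le_exp c

/-- Sequence-level content of the paper's lemma on Zeno behavior: if the triggering
instances `t_k` strictly increase to a finite `t*` and the values `a_k ∈ ℝ^d`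
(`a_k = x_i(t_k)`) are nonzero and converge to `0`, then for every `M > 0` the bound
`‖a_{k+1} − a_k‖ ≤ M(t_{k+1} − t_k)‖a_{k+1}‖` is violated infinitely often. -/
theorem statement8 (d : ℕ) (t : ℕ → ℝ) (ht : StrictMono t)
    (tstar : ℝ) (htlim : Filter.Tendsto t Filter.atTop (nhds tstar))
    (a : ℕ → EuclideanSpace ℝ (Fin d))
    (ha0 : ∀ k, a k ≠ 0)
    (halim : Filter.Tendsto a Filter.atTop (nhds 0)) :
    ∀ M > (0 : ℝ), ∀ K : ℕ, ∃ k ≥ K,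
      M * (t (k + 1) - t k) * ‖a (k + 1)‖ < ‖a (k + 1) - a k‖ := by
  intro M _ K
  by_contra! h
  -- The bound makes `‖a k‖ * exp (M * t k)` nondecreasing from `K` on, although it tends to `0`.
  have hmono : Monotone fun n => ‖a (n + K)‖ * Real.exp (M * t (n + K)) := by
    refine monotone_nat_of_le_succ fun n => ?_
    have hstep := norm_le_exp_mul_norm_of_norm_sub_le (h (n + K) (Nat.le_add_left K n))
    rw [Nat.add_right_comm n 1 K]
    calc ‖a (n + K)‖ * Real.exp (M * t (n + K))
        ≤ Real.exp (M * (t (n + K + 1) - t (n + K))) * ‖a (n + K + 1)‖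
            * Real.exp (M * t (n + K)) := by gcongr
      _ = ‖a (n + K + 1)‖ * Real.exp (M * t (n + K + 1)) := by
        rw [mul_right_comm, ← Real.exp_add, mul_comm]
        ring_nf
  have hlim : Filter.Tendsto (fun n => ‖a (n + K)‖ * Real.exp (M * t (n + K)))
      Filter.atTop (nhds 0) := by
    simpa [Function.comp_def] using (halim.norm.mul (htlim.const_mul M).rexp).comp
      (Filter.tendsto_add_atTop_nat K)
  have hle := hmono.ge_of_tendsto hlim 0
  have hpos : 0 < ‖a (0 + K)‖ * Real.exp (M * t (0 + K)) :=
    mul_pos (norm_pos_iff.mpr (ha0 _)) (Real.exp_pos _)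
  exact hpos.not_ge hle
end

section
/- Let γ_{12} and γ_{21} be class-K∞ functions. There exist class-K∞ functions σ_1, σ_2 such that γ_{12}(σ_2(s)) < σ_1(s) and γ_{21}(σ_1(s)) < σ_2(s) for all s > 0 if and only if γ_{12}(γ_{21}(r)) < r for all r > 0. -/
/-- The composition of two class-K∞ functions is of class K∞. -/
theorem ClassKInf.comp {f g : ℝ → ℝ} (hf : ClassKInf f) (hg : ClassKInf g) :
    ClassKInf (fun r => f (g r)) := by
  obtain ⟨⟨fc, fm, fp, f0⟩, ft⟩ := hf
  obtain ⟨⟨gc, gm, gp, g0⟩, gt⟩ := hg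
  have hmaps : Set.MapsTo g (Set.Ici 0) (Set.Ici 0) := gp
  exact ⟨⟨fc.comp gc hmaps, fm.comp gm hmaps, fun r hr => fp _ (gp r hr), by simp [g0, f0]⟩,
    ft.comp gt⟩

/-- The average of the identity and a class-K∞ function is of class K∞. -/
theorem ClassKInf.average_id {f : ℝ → ℝ} (hf : ClassKInf f) :
    ClassKInf (fun r => (r + f r) / 2) := by
  obtain ⟨⟨fc, fm, fp, f0⟩, ft⟩ := hf
  refine ⟨⟨(continuousOn_id.add fc).div_const 2, fun a ha b hb hab => ?_, fun r hr => ?_,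
    by simp [f0]⟩, (Filter.tendsto_id.atTop_add_atTop ft).atTop_div_const two_pos⟩
  · have := fm ha hb hab
    dsimp only
    linarith
  · have := fp r hr
    positivity

/-- A class-K∞ function takes every positive value at a positive argument. -/
theorem ClassKInf.exists_pos_eq {f : ℝ → ℝ} (hf : ClassKInf f) {r : ℝ} (hr : 0 < r) :
    ∃ s > 0, f s = r := by
  obtain ⟨⟨fc, -, -, f0⟩, ft⟩ := hf
  obtain ⟨b, hrb, hb⟩ := ((ft.eventually_ge_atTop r).and (Filter.eventually_ge_atTop 0)).exists
  obtain ⟨s, hs, rfl⟩ := intermediate_value_Icc hb (fc.mono Set.Icc_subset_Ici_self)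
    (show r ∈ Set.Icc (f 0) (f b) from ⟨f0.trans_le hr.le, hrb⟩)
  refine ⟨s, lt_of_le_of_ne hs.1 ?_, rfl⟩
  rintro rfl
  exact hr.ne' f0

/-- For two subsystems with `μ₁ = μ₂ = max`: there exist class-K∞ functions `σ₁, σ₂`
with `γ₁₂(σ₂(s)) < σ₁(s)` and `γ₂₁(σ₁(s)) < σ₂(s)` for all `s > 0` if and only if the
small-gain condition `γ₁₂(γ₂₁(r)) < r` holds for all `r > 0`. -/
theorem statement9 (γ₁₂ γ₂₁ : ℝ → ℝ) (h₁₂ : ClassKInf γ₁₂) (h₂₁ : ClassKInf γ₂₁) :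
    (∃ σ₁ σ₂ : ℝ → ℝ, ClassKInf σ₁ ∧ ClassKInf σ₂ ∧
        ∀ s > 0, γ₁₂ (σ₂ s) < σ₁ s ∧ γ₂₁ (σ₁ s) < σ₂ s) ↔
      (∀ r > 0, γ₁₂ (γ₂₁ r) < r) := by
  constructor
  · rintro ⟨σ₁, σ₂, hσ₁, hσ₂, h⟩ r hr
    obtain ⟨s, hs, rfl⟩ := hσ₁.exists_pos_eq hr
    obtain ⟨h₁, h₂⟩ := h s hs
    exact (h₁₂.1.2.1 (h₂₁.1.2.2.1 _ hr.le) (hσ₂.1.2.2.1 s hs.le) h₂).trans h₁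
  · intro h
    have hσ := (h₁₂.comp h₂₁).average_id
    refine ⟨_, γ₂₁, hσ, h₂₁, fun s hs => ?_⟩
    have hlt := h s hs
    refine ⟨?_, h₂₁.1.2.1 (hσ.1.2.2.1 s hs.le) hs.le ?_⟩ <;> linarith
end
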